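/- arXiv:1503.01472 — 2 statements merged into one kernel-verified Lean document; each statement's English description precedes it below -/
import Mathlib

section
/- For every τ in the upper half-plane ℍ, S_{2,1}(τ) = η(τ)³; that is, ∑_{k∈ℤ} (4k+1) q^{(4k+1)²/8} = q^{1/8} ∏_{n≥1} (1 − q^n)³. -/
noncomputable section

open Complex

/-- `q = e^{2πiτ}`. -/
def qq (τ : ℂ) : ℂ := exp (2 * ↑Real.pi * I * τ)

/-- The Dedekind eta function `η(τ) = q^{1/24} ∏_{n≥1} (1 − qⁿ)`. -/
def dedekindEta (τ : ℂ) : ℂ := exp (2 * ↑Real.pi * I * τ / 24) * ∏' n : ℕ, (1 - qq τ ^ (n + 1))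

/-- The unary theta function `S_{m,r}(τ) = ∑_{k∈ℤ} (2mk+r) q^{(2mk+r)²/(4m)}`. -/
def Sth (m : ℕ) (r : ℤ) (τ : ℂ) : ℂ :=
  ∑' k : ℤ, ((2 * (m : ℤ) * k + r : ℤ) : ℂ) *
    exp (2 * ↑Real.pi * I * τ * (((2 * (m : ℤ) * k + r : ℤ) : ℂ) ^ 2 / (4 * (m : ℂ))))

open Filter Topology

/-- The finite `q`-Pochhammer symbol `(q; q)_n`. -/
def eulerProd (q : ℂ) (n : ℕ) : ℂ := ∏ i ∈ Finset.range n, (1 - q ^ (i + 1))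

/-- `1 / (q; q)_m` for `m ≥ 0`, extended by `0` to negative `m`. -/
def eulerProdInv (q : ℂ) (m : ℤ) : ℂ := if m < 0 then 0 else (eulerProd q m.toNat)⁻¹

/-- The Gaussian factor `q^{k(k-1)/2}`. -/
def gaussTerm (τ : ℂ) (k : ℤ) : ℂ := exp (Real.pi * I * τ * (k * (k - 1)))

/-- The coefficient of `z^k` in `∏_{0 ≤ i ≤ n} (1 - z q^i) ∏_{1 ≤ i ≤ n} (1 - z⁻¹ q^i)`. -/
def tripleCoeff (τ : ℂ) (n : ℕ) (k : ℤ) : ℂ :=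
  (-1) ^ k * gaussTerm τ k * eulerProd (qq τ) (2 * n + 1) *
    (eulerProdInv (qq τ) (n + k) * eulerProdInv (qq τ) (n + 1 - k))

lemma eulerProd_succ (q : ℂ) (n : ℕ) : eulerProd q (n + 1) = eulerProd q n * (1 - q ^ (n + 1)) :=
  Finset.prod_range_succ _ _

lemma one_sub_pow_ne_zero {q : ℂ} (hq : ‖q‖ < 1) (n : ℕ) : 1 - q ^ (n + 1) ≠ 0 := by
  intro h
  have h1 : ‖q ^ (n + 1)‖ < 1 := by
    rw [norm_pow]
    exact pow_lt_one₀ (norm_nonneg _) hq n.succ_ne_zero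
  rw [← sub_eq_zero.mp h] at h1
  simp at h1

lemma eulerProd_ne_zero {q : ℂ} (hq : ‖q‖ < 1) (n : ℕ) : eulerProd q n ≠ 0 :=
  Finset.prod_ne_zero_iff.mpr fun i _ ↦ one_sub_pow_ne_zero hq i

lemma tendsto_eulerProd {q : ℂ} (hq : ‖q‖ < 1) :
    Tendsto (eulerProd q) atTop (𝓝 (∏' n : ℕ, (1 - q ^ (n + 1)))) :=
  (ModularForm.multipliable_one_sub_pow hq).hasProd.tendsto_prod_nat

lemma tprod_one_sub_pow_ne_zero {q : ℂ} (hq : ‖q‖ < 1) : ∏' n : ℕ, (1 - q ^ (n + 1)) ≠ 0 := by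
  simp_rw [sub_eq_add_neg]
  refine tprod_one_add_ne_zero_of_summable (f := fun n ↦ -q ^ (n + 1))
    (fun i ↦ by simpa [sub_eq_add_neg] using one_sub_pow_ne_zero hq i) ?_
  simpa using (summable_nat_add_iff 1).mpr (summable_geometric_of_lt_one (norm_nonneg _) hq)

lemma eulerProdInv_natCast (q : ℂ) (n : ℕ) : eulerProdInv q n = (eulerProd q n)⁻¹ := by
  simp [eulerProdInv]

lemma eulerProdInv_of_neg (q : ℂ) {m : ℤ} (hm : m < 0) : eulerProdInv q m = 0 := if_pos hm

lemma eulerProdInv_sub_one {q : ℂ} (hq : ‖q‖ < 1) (m : ℤ) :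
    eulerProdInv q (m - 1) = (1 - q ^ m) * eulerProdInv q m := by
  rcases lt_trichotomy m 0 with hm | rfl | hm
  · rw [eulerProdInv_of_neg q hm, eulerProdInv_of_neg q (by lia), mul_zero]
  · simp [eulerProdInv]
  · obtain ⟨n, rfl⟩ : ∃ n : ℕ, m = (n + 1 : ℕ) := ⟨(m - 1).toNat, by lia⟩
    rw [show ((n + 1 : ℕ) : ℤ) - 1 = n by push_cast; ring, eulerProdInv_natCast,
      eulerProdInv_natCast, eulerProd_succ, zpow_natCast]
    have h1 := one_sub_pow_ne_zero hq n
    have h2 := eulerProd_ne_zero hq n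
    field_simp

lemma tendsto_eulerProdInv {q : ℂ} (hq : ‖q‖ < 1) :
    Tendsto (eulerProdInv q) atTop (𝓝 (∏' n : ℕ, (1 - q ^ (n + 1)))⁻¹) := by
  have h := ((tendsto_eulerProd hq).inv₀ (tprod_one_sub_pow_ne_zero hq)).comp
    (tendsto_atTop_atTop.mpr fun b ↦ ⟨(b : ℤ), fun a ha ↦ by lia⟩ :
      Tendsto Int.toNat atTop atTop)
  refine h.congr' ?_
  filter_upwards [eventually_ge_atTop 0] with m hm
  simp [eulerProdInv, hm.not_gt]

lemma exists_norm_eulerProd_le {q : ℂ} (hq : ‖q‖ < 1) : ∃ C, ∀ n, ‖eulerProd q n‖ ≤ C := by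
  obtain ⟨C, hC⟩ := (Metric.isBounded_range_of_tendsto _ (tendsto_eulerProd hq)).exists_norm_le
  exact ⟨C, fun n ↦ hC _ ⟨n, rfl⟩⟩

lemma exists_norm_eulerProdInv_le {q : ℂ} (hq : ‖q‖ < 1) : ∃ C, ∀ m, ‖eulerProdInv q m‖ ≤ C := by
  obtain ⟨C, hC⟩ := (Metric.isBounded_range_of_tendsto _
    ((tendsto_eulerProdInv hq).comp tendsto_natCast_atTop_atTop)).exists_norm_le
  refine ⟨C, fun m ↦ ?_⟩
  rcases lt_or_ge m 0 with hm | hm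
  · rw [eulerProdInv_of_neg q hm, norm_zero]
    exact (norm_nonneg _).trans (hC _ ⟨0, rfl⟩)
  · lift m to ℕ using hm
    exact hC _ ⟨m, rfl⟩

lemma norm_qq_lt_one {τ : ℂ} (hτ : 0 < τ.im) : ‖qq τ‖ < 1 :=
  UpperHalfPlane.norm_exp_two_pi_I_lt_one ⟨τ, hτ⟩

lemma qq_ne_zero (τ : ℂ) : qq τ ≠ 0 := exp_ne_zero _

lemma qq_zpow (τ : ℂ) (k : ℤ) : qq τ ^ k = exp (2 * Real.pi * I * τ * k) := by
  rw [qq, ← exp_int_mul, mul_comm]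

lemma gaussTerm_add_one (τ : ℂ) (k : ℤ) : gaussTerm τ (k + 1) = gaussTerm τ k * qq τ ^ k := by
  rw [qq_zpow, gaussTerm, gaussTerm, ← exp_add]
  congr 1
  push_cast
  ring

lemma gaussTerm_sub_one (τ : ℂ) (k : ℤ) :
    gaussTerm τ (k - 1) = gaussTerm τ k * qq τ ^ (1 - k) := by
  rw [qq_zpow, gaussTerm, gaussTerm, ← exp_add]
  congr 1
  push_cast
  ring

lemma norm_gaussTerm (τ : ℂ) (k : ℤ) :
    ‖gaussTerm τ k‖ = Real.exp (-Real.pi * (τ.im * k ^ 2 - τ.im * k)) := by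
  rw [gaussTerm, norm_exp]
  congr 1
  rw [show (Real.pi * I * τ * (k * (k - 1)) : ℂ) = ((Real.pi * (k * (k - 1)) : ℝ) : ℂ) * (I * τ) by
    push_cast; ring, re_ofReal_mul]
  simp
  ring

lemma summable_abs_mul_norm_gaussTerm {τ : ℂ} (hτ : 0 < τ.im) :
    Summable fun k : ℤ ↦ |(k : ℝ)| * ‖gaussTerm τ k‖ := by
  refine (summable_pow_mul_jacobiTheta₂_term_bound (τ.im / 2) hτ 1).of_nonneg_of_le
    (fun k ↦ by positivity) fun k ↦ ?_
  rw [norm_gaussTerm]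
  push_cast
  rw [pow_one]
  refine mul_le_mul_of_nonneg_left (Real.exp_le_exp.mpr ?_) (abs_nonneg _)
  have := mul_le_mul_of_nonneg_left (le_abs_self (k : ℝ)) (mul_pos Real.pi_pos hτ).le
  linarith

lemma tripleCoeff_succ {τ : ℂ} (hτ : 0 < τ.im) (n : ℕ) (k : ℤ) :
    tripleCoeff τ (n + 1) k = (1 + qq τ ^ (2 * n + 2)) * tripleCoeff τ n k -
      qq τ ^ (n + 1) * (tripleCoeff τ n (k - 1) + tripleCoeff τ n (k + 1)) := by
  have hq := norm_qq_lt_one hτ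
  have h0 := qq_ne_zero τ
  unfold tripleCoeff
  rw [gaussTerm_add_one, gaussTerm_sub_one, show 2 * (n + 1) + 1 = 2 * n + 1 + 1 + 1 by ring,
    eulerProd_succ, eulerProd_succ]
  have e1 : eulerProdInv (qq τ) (n + k) = _ :=
    (congrArg _ (by ring)).trans (eulerProdInv_sub_one hq (n + 1 + k))
  have e2 : eulerProdInv (qq τ) (n + 1 - k) = _ :=
    (congrArg _ (by ring)).trans (eulerProdInv_sub_one hq (n + 2 - k))
  have e3 : eulerProdInv (qq τ) (n + (k - 1)) = _ :=
    (congrArg _ (by ring)).trans (eulerProdInv_sub_one hq (n + k))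
  have e4 : eulerProdInv (qq τ) (n + 1 - (k + 1)) = _ :=
    (congrArg _ (by ring)).trans (eulerProdInv_sub_one hq (n + 1 - k))
  have e5 : ((n : ℤ) + 1 - (k - 1)) = n + 2 - k := by ring
  have e6 : ((n : ℤ) + (k + 1)) = n + 1 + k := by ring
  have e7 : (((n + 1 : ℕ) : ℤ) + k) = n + 1 + k := by push_cast; ring
  have e8 : (((n + 1 : ℕ) : ℤ) + 1 - k) = n + 2 - k := by push_cast; ring
  rw [e3, e4, e1, e2, e5, e6, e7, e8]
  generalize eulerProdInv (qq τ) (n + 1 + k) = A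
  generalize eulerProdInv (qq τ) (n + 2 - k) = B
  generalize eulerProd (qq τ) (2 * n + 1) = D
  generalize gaussTerm τ k = G
  have hneg : (-1 : ℂ) ≠ 0 := by norm_num
  generalize qq τ = q at *
  simp only [zpow_add₀ h0, zpow_sub₀ h0, zpow_add₀ hneg, zpow_sub₀ hneg, zpow_natCast,
    zpow_ofNat]
  have hx : q ^ k ≠ 0 := zpow_ne_zero _ h0
  generalize q ^ k = x at *
  field_simp
  ring

lemma hasSum_tripleCoeff {τ : ℂ} (hτ : 0 < τ.im) (n : ℕ) :
    HasSum (tripleCoeff τ n) 0 ∧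
      HasSum (fun k : ℤ ↦ k * tripleCoeff τ n k) (-eulerProd (qq τ) n ^ 2) := by
  induction n with
  | zero =>
    have hq := one_sub_pow_ne_zero (norm_qq_lt_one hτ) 0
    have hc0 : tripleCoeff τ 0 0 = 1 := by
      simp_all [tripleCoeff, gaussTerm, eulerProd, eulerProdInv]
    have hc1 : tripleCoeff τ 0 1 = -1 := by
      rw [zero_add, pow_one] at hq
      simp [tripleCoeff, gaussTerm, eulerProd, eulerProdInv]
      field_simp
      ring
    have hc : ∀ k ∉ ({0, 1} : Finset ℤ), tripleCoeff τ 0 k = 0 := by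
      intro k hk
      simp only [Finset.mem_insert, Finset.mem_singleton, not_or] at hk
      rcases lt_or_ge k 0 with h | h
      · simp [tripleCoeff, eulerProdInv_of_neg _ h]
      · have h' : (1 : ℤ) - k < 0 := by lia
        simp [tripleCoeff, eulerProdInv_of_neg _ h']
    refine ⟨?_, ?_⟩
    · have h : HasSum (tripleCoeff τ 0) _ := hasSum_sum_of_ne_finset_zero hc
      simpa [hc0, hc1] using h
    · have h : HasSum (fun k : ℤ ↦ k * tripleCoeff τ 0 k) _ :=
        hasSum_sum_of_ne_finset_zero (s := {0, 1}) fun k hk ↦ by simp [hc k hk]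
      simpa [hc1, eulerProd] using h
  | succ n ih =>
    obtain ⟨h0, h1⟩ := ih
    have h0p : HasSum (fun k : ℤ ↦ tripleCoeff τ n (k + 1)) 0 :=
      (Equiv.addRight (1 : ℤ)).hasSum_iff (f := tripleCoeff τ n) |>.mpr h0
    have h0m : HasSum (fun k : ℤ ↦ tripleCoeff τ n (k - 1)) 0 :=
      (Equiv.subRight (1 : ℤ)).hasSum_iff (f := tripleCoeff τ n) |>.mpr h0
    have h1p : HasSum (fun k : ℤ ↦ k * tripleCoeff τ n (k + 1)) (-eulerProd (qq τ) n ^ 2) := by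
      rw [← sub_zero (-eulerProd (qq τ) n ^ 2)]
      refine (((Equiv.addRight (1 : ℤ)).hasSum_iff.mpr h1).sub h0p).congr_fun fun k ↦ ?_
      simp
      ring
    have h1m : HasSum (fun k : ℤ ↦ k * tripleCoeff τ n (k - 1)) (-eulerProd (qq τ) n ^ 2) := by
      rw [← add_zero (-eulerProd (qq τ) n ^ 2)]
      refine (((Equiv.subRight (1 : ℤ)).hasSum_iff.mpr h1).add h0m).congr_fun fun k ↦ ?_
      simp
      ring
    refine ⟨?_, ?_⟩
    · have h := (h0.mul_left (1 + qq τ ^ (2 * n + 2))).sub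
        ((h0m.add h0p).mul_left (qq τ ^ (n + 1)))
      simpa [← tripleCoeff_succ hτ] using h
    · have h := (h1.mul_left (1 + qq τ ^ (2 * n + 2))).sub
        ((h1m.add h1p).mul_left (qq τ ^ (n + 1)))
      have hv : -eulerProd (qq τ) (n + 1) ^ 2 =
          (1 + qq τ ^ (2 * n + 2)) * -eulerProd (qq τ) n ^ 2 -
            qq τ ^ (n + 1) * (-eulerProd (qq τ) n ^ 2 + -eulerProd (qq τ) n ^ 2) := by
        rw [eulerProd_succ]
        ring
      rw [hv]
      refine h.congr_fun fun k ↦ ?_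
      rw [tripleCoeff_succ hτ n k]
      ring

/-- Jacobi's identity for the cube of the Euler product, as a sum over all integers. -/
lemma tsum_neg_one_zpow_mul_gaussTerm {τ : ℂ} (hτ : 0 < τ.im) :
    ∑' k : ℤ, k * ((-1) ^ k * gaussTerm τ k) = -(∏' n : ℕ, (1 - qq τ ^ (n + 1))) ^ 3 := by
  have hq := norm_qq_lt_one hτ
  obtain ⟨C, hC⟩ := exists_norm_eulerProd_le hq
  obtain ⟨D, hD⟩ := exists_norm_eulerProdInv_le hq
  have hP := tprod_one_sub_pow_ne_zero hq
  have hlim := tendsto_eulerProd hq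
  have hinv := tendsto_eulerProdInv hq
  generalize ∏' n : ℕ, (1 - qq τ ^ (n + 1)) = P at *
  have hC0 : 0 ≤ C := (norm_nonneg _).trans (hC 0)
  have hD0 : 0 ≤ D := (norm_nonneg _).trans (hD 0)
  have key : Tendsto (fun n ↦ ∑' k : ℤ, k * tripleCoeff τ n k) atTop
      (𝓝 (∑' k : ℤ, k * ((-1) ^ k * gaussTerm τ k * P * (P⁻¹ * P⁻¹)))) := by
    refine tendsto_tsum_of_dominated_convergence
      ((summable_abs_mul_norm_gaussTerm hτ).mul_right (C * (D * D))) (fun k ↦ ?_)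
      (.of_forall fun n k ↦ ?_)
    · refine Tendsto.const_mul _ (((hlim.comp ?_).const_mul _).mul
        ((hinv.comp ?_).mul (hinv.comp ?_)))
      · exact tendsto_atTop_mono (fun n ↦ by rw [id]; lia) tendsto_id
      · exact tendsto_atTop_add_const_right _ _ tendsto_natCast_atTop_atTop
      · simp_rw [add_sub_assoc]
        exact tendsto_atTop_add_const_right _ _ tendsto_natCast_atTop_atTop
    · simp only [tripleCoeff, norm_mul, norm_zpow, norm_neg, norm_one, one_zpow, one_mul,
        norm_intCast]
      rw [mul_assoc ‖gaussTerm τ k‖, ← mul_assoc |(k : ℝ)|]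
      gcongr
      exacts [hC _, hD _, hD _]
  simp_rw [(hasSum_tripleCoeff hτ _).2.tsum_eq] at key
  have h := tendsto_nhds_unique key (hlim.pow 2).neg
  simp_rw [← mul_assoc, tsum_mul_right] at h
  simp_rw [← mul_assoc]
  field_simp at h
  exact h

lemma HasSum.int_even_add_odd {f : ℤ → ℂ} {a b : ℂ}
    (he : HasSum (fun k ↦ f (2 * k)) a) (ho : HasSum (fun k ↦ f (2 * k + 1)) b) :
    HasSum f (a + b) := by
  have h2 := mul_right_injective₀ (two_ne_zero' ℤ)
  replace ho := ((add_left_injective 1).comp h2).hasSum_range_iff.2 ho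
  refine (h2.hasSum_range_iff.2 he).add_isCompl ?_ ho
  simpa [Function.comp_def] using Int.isCompl_even_odd

lemma summable_neg_one_zpow_mul_gaussTerm {τ : ℂ} (hτ : 0 < τ.im) :
    Summable fun k : ℤ ↦ (k * ((-1) ^ k * gaussTerm τ k) : ℂ) :=
  (summable_abs_mul_norm_gaussTerm hτ).of_norm_bounded fun k ↦ by simp

lemma hasSum_four_mul_add_one_mul_gaussTerm {τ : ℂ} (hτ : 0 < τ.im) :
    HasSum (fun k : ℤ ↦ (4 * k + 1) * gaussTerm τ (2 * k + 1))
      ((∏' n : ℕ, (1 - qq τ ^ (n + 1))) ^ 3) := by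
  have hs := summable_neg_one_zpow_mul_gaussTerm hτ
  have ht := tsum_neg_one_zpow_mul_gaussTerm hτ
  obtain ⟨f, hf⟩ : ∃ f : ℤ → ℂ, f = fun k : ℤ ↦ k * ((-1) ^ k * gaussTerm τ k) := ⟨_, rfl⟩
  rw [← hf] at hs ht
  have h2 := mul_right_injective₀ (two_ne_zero' ℤ)
  have he : HasSum (fun k ↦ f (2 * k)) _ := (hs.comp_injective h2).hasSum
  have ho : HasSum (fun k ↦ f (2 * k + 1)) _ :=
    (hs.comp_injective ((add_left_injective 1).comp h2)).hasSum
  have h := (he.int_even_add_odd ho).tsum_eq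
  rw [ht] at h
  rw [← neg_neg (_ ^ 3), h]
  refine (((Equiv.neg ℤ).hasSum_iff.mpr he).add ho).neg.congr_fun
    fun k ↦ ?_
  have hg : gaussTerm τ (2 * -k) = gaussTerm τ (2 * k + 1) := by
    unfold gaussTerm
    congr 1
    push_cast
    ring
  have hneg : (-1 : ℂ) ≠ 0 := by norm_num
  simp only [Function.comp_apply, Equiv.neg_apply, hf, hg, zpow_add₀ hneg, zpow_mul]
  push_cast
  simp
  ring

/-- For every `τ` in the upper half-plane, `S_{2,1}(τ) = η(τ)³`, i.e.
`∑_{k∈ℤ} (4k+1) q^{(4k+1)²/8} = q^{1/8} ∏_{n≥1} (1 − qⁿ)³`. -/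
theorem stmt_5 (τ : ℂ) (hτ : 0 < τ.im) : Sth 2 1 τ = dedekindEta τ ^ 3 := by
  rw [dedekindEta, mul_pow, ← (hasSum_four_mul_add_one_mul_gaussTerm hτ).tsum_eq, ← tsum_mul_left,
    Sth]
  refine tsum_congr fun k ↦ ?_
  rw [gaussTerm, mul_left_comm, ← exp_nat_mul, ← exp_add]
  push_cast
  ring_nf
end
end

section
/- For every τ in the upper half-plane ℍ, S_{3,1}(τ) = η(2τ)⁵ / η(4τ)²; that is, ∑_{k∈ℤ} (6k+1) q^{(6k+1)²/12} = q^{1/12} ∏_{n≥1} (1 − q^{2n})⁵ (1 − q^{4n})^{−2}. -/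
noncomputable section

open Complex

open Filter Topology

/-- The `q`-Pochhammer symbol `(z; q)_∞ = ∏_{n≥0} (1 − z qⁿ)`. -/
def qPoch (q z : ℂ) : ℂ := ∏' n : ℕ, (1 - z * q ^ n)

section qPoch

variable {q : ℂ}

lemma summable_norm_neg_mul_pow (hq : ‖q‖ < 1) (z : ℂ) :
    Summable fun n : ℕ ↦ ‖-(z * q ^ n)‖ := by
  simpa using (summable_geometric_of_lt_one (norm_nonneg q) hq).mul_left ‖z‖

lemma multipliable_qPoch (hq : ‖q‖ < 1) (z : ℂ) :
    Multipliable fun n : ℕ ↦ 1 - z * q ^ n := by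
  simpa [sub_eq_add_neg] using
    multipliable_one_add_of_summable (summable_norm_neg_mul_pow hq z)

lemma qPoch_eq_mul (hq : ‖q‖ < 1) (z : ℂ) : qPoch q z = (1 - z) * qPoch q (z * q) := by
  have h := multipliable_qPoch hq (z * q)
  rw [qPoch, tprod_eq_zero_mul', qPoch]
  · simp [pow_succ', mul_assoc]
  · simpa [pow_succ', mul_assoc] using h

lemma continuous_qPoch (hq : ‖q‖ < 1) : Continuous (qPoch q) := by
  refine continuous_iff_continuousAt.mpr fun z ↦ ?_
  simp only [ContinuousAt, qPoch, sub_eq_add_neg]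
  refine tendsto_tprod_one_add_of_dominated_convergence
    (bound := fun n ↦ (‖z‖ + 1) * ‖q‖ ^ n)
    ((summable_geometric_of_lt_one (norm_nonneg q) hq).mul_left _)
    (fun n ↦ (by fun_prop : Continuous fun w : ℂ ↦ -(w * q ^ n)).tendsto z) ?_
  have h : ∀ᶠ w in 𝓝 z, ‖w‖ < ‖z‖ + 1 :=
    continuous_norm.continuousAt.eventually_lt continuousAt_const (by simp)
  filter_upwards [h] with w hw n
  rw [norm_neg, norm_mul, norm_pow]
  gcongr

lemma qPoch_zero_right : qPoch q 0 = 1 := by simp [qPoch]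

lemma qPoch_ne_zero (hq : ‖q‖ < 1) {z : ℂ} (hz : ‖z‖ < 1) : qPoch q z ≠ 0 := by
  simp only [qPoch, sub_eq_add_neg]
  refine tprod_one_add_ne_zero_of_summable (fun n h ↦ ?_) (summable_norm_neg_mul_pow hq z)
  have h1 : z * q ^ n = 1 := by linear_combination -h
  have h2 : ‖z‖ * ‖q‖ ^ n = 1 := by rw [← norm_pow, ← norm_mul, h1, norm_one]
  have h3 : ‖q‖ ^ n ≤ 1 := pow_le_one₀ (norm_nonneg q) hq.le
  nlinarith [norm_nonneg z, norm_nonneg q]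

lemma qPoch_zpow_eq_zero (hq0 : q ≠ 0) {n : ℤ} (hn : n ≤ 0) : qPoch q (q ^ n) = 0 := by
  refine tprod_of_exists_eq_zero ⟨n.natAbs, ?_⟩
  rw [← zpow_natCast, ← zpow_add₀ hq0]
  simp [show n + |n| = 0 by grind]

lemma exists_norm_qPoch_le (hq : ‖q‖ < 1) : ∃ C, 0 ≤ C ∧ ∀ z, ‖z‖ ≤ 1 → ‖qPoch q z‖ ≤ C := by
  obtain ⟨C, hC⟩ := (isCompact_closedBall (0 : ℂ) 1).exists_bound_of_continuousOn
    (continuous_qPoch hq).continuousOn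
  have h (z : ℂ) (hz : ‖z‖ ≤ 1) : ‖qPoch q z‖ ≤ C := hC z (by simpa using hz)
  exact ⟨C, (norm_nonneg _).trans (h 0 (by simp)), h⟩

lemma tendsto_qPoch_one (hq : ‖q‖ < 1) {u : ℕ → ℂ} (hu : Tendsto u atTop (𝓝 0)) :
    Tendsto (fun n ↦ qPoch q (u n)) atTop (𝓝 1) := by
  simpa [qPoch_zero_right, Function.comp_def] using
    ((continuous_qPoch hq).tendsto 0).comp hu

end qPoch

section quintuple

variable {Q z : ℂ}

/-- The term `z^{3k} q^{(3k²−k)/2}` of the quintuple product series, with `q = Q²`. -/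
def quintTerm (Q z : ℂ) (k : ℤ) : ℂ := z ^ (3 * k) * Q ^ (3 * k ^ 2 - k)

/-- The terms of a finite form of the quintuple product series, with `q = Q²`. -/
def finTerm (Q z A B : ℂ) (k : ℤ) : ℂ :=
  (1 - z * (Q ^ 2) ^ k) * quintTerm Q z k *
    (qPoch (Q ^ 2) (A * (Q ^ 2) ^ k) * qPoch (Q ^ 2) (B * ((Q ^ 2) ^ k)⁻¹) *
      qPoch (Q ^ 2) (z ^ 2 * B * (Q ^ 2) ^ k) * qPoch (Q ^ 2) ((z ^ 2)⁻¹ * A * ((Q ^ 2) ^ k)⁻¹))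

/-- The certificate whose differences give the recurrence satisfied by `finTerm` in `B`. -/
def finCert (Q z A B : ℂ) (k : ℤ) : ℂ :=
  B * ((Q ^ 2) ^ k)⁻¹ * quintTerm Q z k *
    (qPoch (Q ^ 2) (A * (Q ^ 2) ^ k * (Q ^ 2)⁻¹) * qPoch (Q ^ 2) (B * Q ^ 2 * ((Q ^ 2) ^ k)⁻¹) *
      qPoch (Q ^ 2) (z ^ 2 * B * (Q ^ 2) ^ k) * qPoch (Q ^ 2) ((z ^ 2)⁻¹ * A * ((Q ^ 2) ^ k)⁻¹))

lemma quintTerm_add_one (hQ0 : Q ≠ 0) (hz : z ≠ 0) (k : ℤ) :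
    quintTerm Q z (k + 1) = quintTerm Q z k * (z ^ 3 * ((Q ^ 2) ^ k) ^ 3 * Q ^ 2) := by
  have h1 : z ^ (3 * (k + 1)) = z ^ (3 * k) * z ^ 3 := by
    rw [mul_add, zpow_add₀ hz]; norm_cast
  have h2 : Q ^ (3 * (k + 1) ^ 2 - (k + 1)) = Q ^ (3 * k ^ 2 - k) * (((Q ^ 2) ^ k) ^ 3 * Q ^ 2) := by
    rw [show 3 * (k + 1) ^ 2 - (k + 1) = (3 * k ^ 2 - k) + ((2 * k) * 3 + 2) by ring,
      zpow_add₀ hQ0, zpow_add₀ hQ0, zpow_mul, zpow_mul]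
    norm_cast
  rw [quintTerm, quintTerm, h1, h2]
  ring

lemma finTerm_sub (hQ0 : Q ≠ 0) (hQ : ‖Q ^ 2‖ < 1) (hz : z ≠ 0) (A B : ℂ) (k : ℤ) :
    finTerm Q z A B k - (1 - A * B * (Q ^ 2)⁻¹) * (1 + B * z) * finTerm Q z A (B * Q ^ 2) k =
      finCert Q z A B (k + 1) - finCert Q z A B k := by
  have hq0 : Q ^ 2 ≠ 0 := pow_ne_zero 2 hQ0
  have hy : (Q ^ 2) ^ (k + 1) = (Q ^ 2) ^ k * Q ^ 2 := zpow_add_one₀ hq0 k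
  rw [finTerm, finTerm, finCert, finCert, quintTerm_add_one hQ0 hz, hy]
  have hy0 : (Q ^ 2) ^ k ≠ 0 := zpow_ne_zero k hq0
  generalize (Q ^ 2) ^ k = y at hy0 ⊢
  generalize quintTerm Q z k = w
  generalize Q ^ 2 = q at hQ hq0 ⊢
  have e1 : qPoch q (A * y * q⁻¹) = (1 - A * y * q⁻¹) * qPoch q (A * y) := by
    rw [qPoch_eq_mul hQ, inv_mul_cancel_right₀ hq0]
  have e2 : qPoch q (B * y⁻¹) = (1 - B * y⁻¹) * qPoch q (B * q * y⁻¹) := by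
    rw [qPoch_eq_mul hQ, mul_right_comm B]
  have e3 : qPoch q (z ^ 2 * B * y) = (1 - z ^ 2 * B * y) * qPoch q (z ^ 2 * B * y * q) :=
    qPoch_eq_mul hQ _
  have e4 : qPoch q ((z ^ 2)⁻¹ * A * (y * q)⁻¹) =
      (1 - (z ^ 2)⁻¹ * A * (y * q)⁻¹) * qPoch q ((z ^ 2)⁻¹ * A * y⁻¹) := by
    rw [qPoch_eq_mul hQ]
    congr 2
    field_simp
  rw [show A * (y * q) * q⁻¹ = A * y by field_simp,
    show B * q * (y * q)⁻¹ = B * y⁻¹ by field_simp,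
    show z ^ 2 * (B * q) * y = z ^ 2 * B * y * q by ring,
    show z ^ 2 * B * (y * q) = z ^ 2 * B * y * q by ring, e1, e2, e3, e4]
  field_simp
  ring

lemma finTerm_symm (hQ0 : Q ≠ 0) (hz : z ≠ 0) (A B : ℂ) (k : ℤ) :
    finTerm Q z A B k = -z * finTerm Q z⁻¹ B A (-k) := by
  have h : quintTerm Q z⁻¹ (-k) = quintTerm Q z k * (Q ^ 2) ^ k := by
    rw [quintTerm, quintTerm, mul_neg, inv_zpow', neg_neg,
      show 3 * (-k) ^ 2 - -k = (3 * k ^ 2 - k) + 2 * k by ring, zpow_add₀ hQ0, zpow_mul Q 2 k]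
    norm_cast
    ring
  rw [finTerm, finTerm, h]
  have hy0 : (Q ^ 2) ^ k ≠ 0 := zpow_ne_zero k (pow_ne_zero 2 hQ0)
  simp only [zpow_neg, inv_inv, inv_pow]
  field_simp
  ring

lemma finTerm_eq_zero (hQ0 : Q ≠ 0) {a b k : ℤ} (h : a + k ≤ 0 ∨ b - k ≤ 0) :
    finTerm Q z ((Q ^ 2) ^ a) ((Q ^ 2) ^ b) k = 0 := by
  have hq0 : Q ^ 2 ≠ 0 := pow_ne_zero 2 hQ0
  rw [finTerm, ← zpow_neg, ← zpow_add₀ hq0, ← zpow_add₀ hq0]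
  rcases h with h | h
  · rw [qPoch_zpow_eq_zero hq0 h]; simp
  · rw [← sub_eq_add_neg b, qPoch_zpow_eq_zero hq0 h]; simp

lemma finCert_eq_zero (hQ0 : Q ≠ 0) {a b k : ℤ} (h : a + k ≤ 0 ∨ b + 1 - k ≤ 0) :
    finCert Q z ((Q ^ 2) ^ a) ((Q ^ 2) ^ b) k = 0 := by
  have hq0 : Q ^ 2 ≠ 0 := pow_ne_zero 2 hQ0
  rw [finCert, ← zpow_neg, ← zpow_add₀ hq0, ← zpow_add_one₀ hq0, ← zpow_add₀ hq0 a,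
    ← zpow_add₀ hq0 (b + 1), ← zpow_sub_one₀ hq0]
  rcases h with h | h
  · rw [qPoch_zpow_eq_zero hq0 (by lia)]; simp
  · rw [← sub_eq_add_neg (b + 1), qPoch_zpow_eq_zero hq0 h]; simp

lemma summable_finTerm (hQ0 : Q ≠ 0) (a b : ℤ) :
    Summable (finTerm Q z ((Q ^ 2) ^ a) ((Q ^ 2) ^ b)) :=
  summable_of_ne_finset_zero (s := Finset.Icc (-a) b) fun k hk ↦
    finTerm_eq_zero hQ0 (by rw [Finset.mem_Icc] at hk; lia)

lemma summable_finCert (hQ0 : Q ≠ 0) (a b : ℤ) :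
    Summable (finCert Q z ((Q ^ 2) ^ a) ((Q ^ 2) ^ b)) :=
  summable_of_ne_finset_zero (s := Finset.Icc (-a) (b + 1)) fun k hk ↦
    finCert_eq_zero hQ0 (by rw [Finset.mem_Icc] at hk; lia)

lemma tsum_finTerm_step (hQ0 : Q ≠ 0) (hQ : ‖Q ^ 2‖ < 1) (hz : z ≠ 0) (a b : ℤ) :
    ∑' k, finTerm Q z ((Q ^ 2) ^ a) ((Q ^ 2) ^ b) k =
      (1 - (Q ^ 2) ^ (a + b - 1)) * (1 + (Q ^ 2) ^ b * z) *
        ∑' k, finTerm Q z ((Q ^ 2) ^ a) ((Q ^ 2) ^ (b + 1)) k := by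
  have hq0 : Q ^ 2 ≠ 0 := pow_ne_zero 2 hQ0
  have hG := summable_finCert (z := z) hQ0 a b
  have hG' : Summable fun k ↦ finCert Q z ((Q ^ 2) ^ a) ((Q ^ 2) ^ b) (k + 1) :=
    (Equiv.addRight (1 : ℤ)).summable_iff.mpr hG
  have hF := summable_finTerm (z := z) hQ0 a b
  have hF' := summable_finTerm (z := z) hQ0 a (b + 1)
  have key : ∑' k, (finCert Q z ((Q ^ 2) ^ a) ((Q ^ 2) ^ b) (k + 1) -
      finCert Q z ((Q ^ 2) ^ a) ((Q ^ 2) ^ b) k) = 0 := by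
    rw [hG'.tsum_sub hG, sub_eq_zero]
    exact (Equiv.addRight (1 : ℤ)).tsum_eq (finCert Q z ((Q ^ 2) ^ a) ((Q ^ 2) ^ b))
  rw [← sub_eq_zero, ← tsum_mul_left, ← hF.tsum_sub (hF'.mul_left _), ← key]
  refine tsum_congr fun k ↦ ?_
  rw [← finTerm_sub hQ0 hQ hz, zpow_sub_one₀ hq0, zpow_add₀ hq0 a b, zpow_add_one₀ hq0 b]

lemma tsum_finTerm_symm (hQ0 : Q ≠ 0) (hz : z ≠ 0) (A B : ℂ) :
    ∑' k, finTerm Q z A B k = -z * ∑' k, finTerm Q z⁻¹ B A k := by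
  rw [← (Equiv.neg ℤ).tsum_eq (finTerm Q z⁻¹ B A), ← tsum_mul_left]
  exact tsum_congr fun k ↦ finTerm_symm hQ0 hz A B k

lemma tsum_finTerm_diag_step (hQ0 : Q ≠ 0) (hQ : ‖Q ^ 2‖ < 1) (hz : z ≠ 0) (a : ℤ) :
    ∑' k, finTerm Q z ((Q ^ 2) ^ a) ((Q ^ 2) ^ a) k =
      (1 - (Q ^ 2) ^ (2 * a - 1)) * (1 - (Q ^ 2) ^ (2 * a)) *
        (1 + (Q ^ 2) ^ a * z) * (1 + (Q ^ 2) ^ a * z⁻¹) *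
        ∑' k, finTerm Q z ((Q ^ 2) ^ (a + 1)) ((Q ^ 2) ^ (a + 1)) k := by
  rw [tsum_finTerm_step hQ0 hQ hz, tsum_finTerm_symm hQ0 hz,
    tsum_finTerm_step hQ0 hQ (inv_ne_zero hz), tsum_finTerm_symm hQ0 hz ((Q ^ 2) ^ (a + 1)),
    show a + a - 1 = 2 * a - 1 by ring, show a + 1 + a - 1 = 2 * a by ring]
  ring


lemma tsum_finTerm_one (hQ0 : Q ≠ 0) :
    ∑' k, finTerm Q z (Q ^ 2) (Q ^ 2) k = (1 - z) * (qPoch (Q ^ 2) (Q ^ 2) ^ 2 *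
      qPoch (Q ^ 2) (z ^ 2 * Q ^ 2) * qPoch (Q ^ 2) ((z ^ 2)⁻¹ * Q ^ 2)) := by
  rw [tsum_eq_single 0 fun k hk ↦ ?_]
  · simp only [finTerm, quintTerm, mul_zero, zpow_zero, mul_one, inv_one, ne_eq, OfNat.ofNat_ne_zero,
      not_false_eq_true, zero_pow, sub_zero]
    ring
  · simpa using finTerm_eq_zero (z := z) hQ0 (a := 1) (b := 1) (k := k) (by lia)

lemma one_sub_ne_zero_of_norm_lt_one {x : ℂ} (hx : ‖x‖ < 1) : 1 - x ≠ 0 := by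
  intro h
  rw [← sub_eq_zero.mp h, norm_one] at hx
  exact hx.false

lemma tsum_finTerm_diag (hQ0 : Q ≠ 0) (hQ : ‖Q ^ 2‖ < 1) (hz : ‖z‖ = 1) (m : ℕ) :
    (∑' k, finTerm Q z ((Q ^ 2) ^ (m + 1 : ℤ)) ((Q ^ 2) ^ (m + 1 : ℤ)) k) *
        (qPoch (Q ^ 2) (Q ^ 2) * qPoch (Q ^ 2) (-(Q ^ 2 * z)) * qPoch (Q ^ 2) (-(Q ^ 2 * z⁻¹))) =
      (∑' k, finTerm Q z (Q ^ 2) (Q ^ 2) k) *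
        (qPoch (Q ^ 2) ((Q ^ 2) ^ (2 * m + 1 : ℤ)) * qPoch (Q ^ 2) (-((Q ^ 2) ^ (m + 1 : ℤ) * z)) *
          qPoch (Q ^ 2) (-((Q ^ 2) ^ (m + 1 : ℤ) * z⁻¹))) := by
  have hz0 : z ≠ 0 := by rw [← norm_ne_zero_iff, hz]; exact one_ne_zero
  have hq0 : Q ^ 2 ≠ 0 := pow_ne_zero 2 hQ0
  induction m with
  | zero => simp
  | succ m ih =>
    have hlt (n : ℤ) (hn : 0 < n) : ‖(Q ^ 2) ^ n‖ < 1 := by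
      rw [norm_zpow]
      exact zpow_lt_one₀ (norm_pos_iff.mpr hq0) hQ hn
    have h1 := one_sub_ne_zero_of_norm_lt_one (hlt (2 * (m + 1 : ℤ) - 1) (by lia))
    have h2 := one_sub_ne_zero_of_norm_lt_one (hlt (2 * (m + 1 : ℤ)) (by lia))
    have h3 : 1 - -((Q ^ 2) ^ (m + 1 : ℤ) * z) ≠ 0 := one_sub_ne_zero_of_norm_lt_one <| by
      rw [norm_neg, norm_mul, hz, mul_one]; exact hlt _ (by lia)
    have h4 : 1 - -((Q ^ 2) ^ (m + 1 : ℤ) * z⁻¹) ≠ 0 := one_sub_ne_zero_of_norm_lt_one <| by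
      rw [norm_neg, norm_mul, norm_inv, hz, inv_one, mul_one]; exact hlt _ (by lia)
    rw [tsum_finTerm_diag_step hQ0 hQ hz0, qPoch_eq_mul hQ ((Q ^ 2) ^ (2 * m + 1 : ℤ)),
      qPoch_eq_mul hQ ((Q ^ 2) ^ (2 * m + 1 : ℤ) * Q ^ 2),
      qPoch_eq_mul hQ (-((Q ^ 2) ^ (m + 1 : ℤ) * z)),
      qPoch_eq_mul hQ (-((Q ^ 2) ^ (m + 1 : ℤ) * z⁻¹)), neg_mul, neg_mul,
      mul_right_comm _ z, mul_right_comm _ z⁻¹, ← zpow_add_one₀ hq0, ← zpow_add_one₀ hq0,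
      ← zpow_add_one₀ hq0, show (2 * m + 1 : ℤ) = 2 * (m + 1 : ℤ) - 1 by ring,
      show 2 * (m + 1 : ℤ) - 1 + 1 = 2 * (m + 1 : ℤ) by ring] at ih
    push_cast
    refine mul_left_cancel₀ (mul_ne_zero (mul_ne_zero h1 h2) (mul_ne_zero h3 h4)) ?_
    linear_combination ih

lemma summable_linear_mul_pow_natAbs {r : ℝ} (hr0 : 0 ≤ r) (hr : r < 1) :
    Summable fun k : ℤ ↦ (6 * (k.natAbs : ℝ) + 1) * r ^ k.natAbs := by
  have h : Summable fun n : ℕ ↦ (6 * (n : ℝ) + 1) * r ^ n := by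
    have h1 := summable_pow_mul_geometric_of_norm_lt_one 1
      (r := r) (by rwa [Real.norm_of_nonneg hr0])
    have h0 := summable_geometric_of_lt_one hr0 hr
    refine ((h1.mul_left 6).add h0).congr fun n ↦ ?_
    ring
  exact Summable.of_nat_of_neg (by simpa using h) (by simpa using h)

lemma norm_zpow_le_pow_natAbs (hQ0 : Q ≠ 0) (hQ : ‖Q‖ < 1) {n k : ℤ} (h : |k| ≤ n) :
    ‖Q ^ n‖ ≤ ‖Q‖ ^ k.natAbs := by
  rw [norm_zpow, ← zpow_natCast, Int.natCast_natAbs]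
  exact zpow_le_zpow_right_of_le_one₀ (norm_pos_iff.mpr hQ0) hQ.le h

lemma abs_le_three_mul_sq_add (k : ℤ) : |k| ≤ 3 * k ^ 2 + k := by
  rcases abs_cases k with ⟨h, _⟩ | ⟨h, _⟩ <;> rw [h] <;> nlinarith

lemma abs_le_three_mul_sq_sub (k : ℤ) : |k| ≤ 3 * k ^ 2 - k := by
  simpa only [abs_neg, neg_sq, ← sub_eq_add_neg] using abs_le_three_mul_sq_add (-k)

lemma one_sub_mul_quintTerm (hQ0 : Q ≠ 0) (hz : z ≠ 0) (k : ℤ) :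
    (1 - z * (Q ^ 2) ^ k) * quintTerm Q z k =
      z ^ (3 * k) * Q ^ (3 * k ^ 2 - k) - z ^ (3 * k + 1) * Q ^ (3 * k ^ 2 + k) := by
  have h : Q ^ (3 * k ^ 2 + k) = Q ^ (3 * k ^ 2 - k) * (Q ^ 2) ^ k := by
    rw [show 3 * k ^ 2 + k = (3 * k ^ 2 - k) + 2 * k by ring, zpow_add₀ hQ0, zpow_mul Q 2 k]
    norm_cast
  rw [quintTerm, h, zpow_add_one₀ hz]
  ring

lemma norm_one_sub_mul_quintTerm_le (hQ0 : Q ≠ 0) (hQ : ‖Q‖ < 1) (hz : ‖z‖ = 1) (k : ℤ) :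
    ‖(1 - z * (Q ^ 2) ^ k) * quintTerm Q z k‖ ≤ 2 * ‖Q‖ ^ k.natAbs := by
  have hz0 : z ≠ 0 := by rw [← norm_ne_zero_iff, hz]; exact one_ne_zero
  rw [one_sub_mul_quintTerm hQ0 hz0, two_mul]
  refine (norm_sub_le _ _).trans (add_le_add ?_ ?_)
  · rw [norm_mul, norm_zpow, hz, one_zpow, one_mul]
    exact norm_zpow_le_pow_natAbs hQ0 hQ (abs_le_three_mul_sq_sub k)
  · rw [norm_mul, norm_zpow, hz, one_zpow, one_mul]
    exact norm_zpow_le_pow_natAbs hQ0 hQ (abs_le_three_mul_sq_add k)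

lemma exists_norm_finTerm_le (hQ0 : Q ≠ 0) (hQ : ‖Q‖ < 1) (hz : ‖z‖ = 1) :
    ∃ C, ∀ (a k : ℤ),
      ‖finTerm Q z ((Q ^ 2) ^ a) ((Q ^ 2) ^ a) k‖ ≤ 2 * ‖Q‖ ^ k.natAbs * C := by
  have hq0 : Q ^ 2 ≠ 0 := pow_ne_zero 2 hQ0
  have hq : ‖Q ^ 2‖ < 1 := by rw [norm_pow]; exact pow_lt_one₀ (norm_nonneg Q) hQ two_ne_zero
  obtain ⟨C, hC0, hC⟩ := exists_norm_qPoch_le hq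
  refine ⟨C * C * C * C, fun a k ↦ ?_⟩
  by_cases h : a + k ≤ 0 ∨ a - k ≤ 0
  · rw [finTerm_eq_zero hQ0 h, norm_zero]
    positivity
  · have hle (n : ℤ) (hn : 0 ≤ n) : ‖(Q ^ 2) ^ n‖ ≤ 1 := by
      rw [norm_zpow]
      exact zpow_le_one₀ (norm_pos_iff.mpr hq0) hq.le hn
    have h1 := hle (a + k) (by lia)
    have h2 := hle (a + -k) (by lia)
    rw [finTerm, mul_assoc (z ^ 2), mul_assoc (z ^ 2)⁻¹, ← zpow_neg, ← zpow_add₀ hq0,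
      ← zpow_add₀ hq0]
    refine norm_mul_le_of_le (norm_one_sub_mul_quintTerm_le hQ0 hQ hz k)
      (norm_mul_le_of_le (norm_mul_le_of_le (norm_mul_le_of_le (hC _ h1) (hC _ h2))
        (hC _ ?_)) (hC _ ?_))
    · simpa only [norm_mul, norm_pow, hz, one_pow, one_mul] using h1
    · simpa only [norm_mul, norm_inv, norm_pow, hz, one_pow, inv_one, one_mul] using h2

/-- The quintuple product identity, for `q = Q²` and `z` on the unit circle. -/
theorem quintuple_product (hQ0 : Q ≠ 0) (hQ : ‖Q‖ < 1) (hz : ‖z‖ = 1) :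
    (∑' k, (1 - z * (Q ^ 2) ^ k) * quintTerm Q z k) *
        (qPoch (Q ^ 2) (-(Q ^ 2 * z)) * qPoch (Q ^ 2) (-(Q ^ 2 * z⁻¹))) =
      (1 - z) * (qPoch (Q ^ 2) (Q ^ 2) *
        qPoch (Q ^ 2) (z ^ 2 * Q ^ 2) * qPoch (Q ^ 2) ((z ^ 2)⁻¹ * Q ^ 2)) := by
  have hq : ‖Q ^ 2‖ < 1 := by rw [norm_pow]; exact pow_lt_one₀ (norm_nonneg Q) hQ two_ne_zero
  have hpow : Tendsto (fun m : ℕ ↦ (Q ^ 2) ^ (m + 1 : ℤ)) atTop (𝓝 0) := by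
    have h := (tendsto_pow_atTop_nhds_zero_of_norm_lt_one hq).comp (tendsto_add_atTop_nat 1)
    refine h.congr fun m ↦ ?_
    rw [Function.comp_apply, ← zpow_natCast, Nat.cast_add_one]
  have hpow' : Tendsto (fun m : ℕ ↦ (Q ^ 2) ^ (2 * m + 1 : ℤ)) atTop (𝓝 0) := by
    have h := hpow.comp ((tendsto_id (α := ℕ)).const_mul_atTop' two_pos)
    refine h.congr fun m ↦ ?_
    rw [Function.comp_apply, id, Nat.cast_mul, Nat.cast_ofNat]
  have hlim (c : ℂ) : Tendsto (fun m : ℕ ↦ qPoch (Q ^ 2) ((Q ^ 2) ^ (m + 1 : ℤ) * c)) atTop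
      (𝓝 1) := tendsto_qPoch_one hq (by simpa using hpow.mul_const c)
  have hR : Tendsto (fun m : ℕ ↦ qPoch (Q ^ 2) ((Q ^ 2) ^ (2 * m + 1 : ℤ)) *
      qPoch (Q ^ 2) (-((Q ^ 2) ^ (m + 1 : ℤ) * z)) *
        qPoch (Q ^ 2) (-((Q ^ 2) ^ (m + 1 : ℤ) * z⁻¹))) atTop (𝓝 1) := by
    simpa using ((tendsto_qPoch_one hq hpow').mul (hlim (-z))).mul (hlim (-z⁻¹))
  obtain ⟨C, hC⟩ := exists_norm_finTerm_le hQ0 hQ hz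
  have hsum : Summable fun k : ℤ ↦ ‖Q‖ ^ k.natAbs :=
    (summable_linear_mul_pow_natAbs (norm_nonneg Q) hQ).of_nonneg_of_le (fun _ ↦ by positivity)
      fun k ↦ le_mul_of_one_le_left (by positivity) (by simp)
  have hL : Tendsto (fun m : ℕ ↦
      ∑' k, finTerm Q z ((Q ^ 2) ^ (m + 1 : ℤ)) ((Q ^ 2) ^ (m + 1 : ℤ)) k) atTop
      (𝓝 (∑' k, (1 - z * (Q ^ 2) ^ k) * quintTerm Q z k)) := by
    refine tendsto_tsum_of_dominated_convergence ((hsum.mul_left 2).mul_right C) (fun k ↦ ?_)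
      (.of_forall fun m k ↦ hC _ k)
    have h := (((hlim ((Q ^ 2) ^ k)).mul (hlim ((Q ^ 2) ^ k)⁻¹)).mul
      (hlim (z ^ 2 * (Q ^ 2) ^ k))).mul (hlim ((z ^ 2)⁻¹ * ((Q ^ 2) ^ k)⁻¹))
    convert h.const_mul ((1 - z * (Q ^ 2) ^ k) * quintTerm Q z k) using 2 with m
    · rw [finTerm, mul_left_comm _ (z ^ 2), mul_left_comm _ (z ^ 2)⁻¹, ← mul_assoc (z ^ 2),
        ← mul_assoc (z ^ 2)⁻¹]
    · simp
  have h := tendsto_nhds_unique (hL.mul_const _)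
    ((hR.const_mul _).congr fun m ↦ (tsum_finTerm_diag hQ0 hq hz m).symm)
  rw [mul_one, tsum_finTerm_one hQ0] at h
  refine mul_left_cancel₀ (qPoch_ne_zero hq hq) ?_
  linear_combination h

lemma norm_zpow_sub_one_le (hz : ‖z‖ = 1) (n : ℤ) : ‖z ^ n - 1‖ ≤ n.natAbs * ‖z - 1‖ := by
  have hz0 : z ≠ 0 := by rw [← norm_ne_zero_iff, hz]; exact one_ne_zero
  have hnat (n : ℕ) : ‖z ^ n - 1‖ ≤ n * ‖z - 1‖ := by
    rw [← mul_geom_sum, norm_mul, mul_comm]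
    gcongr
    exact (norm_sum_le _ _).trans (by simp [hz])
  rcases n.eq_nat_or_neg with ⟨m, rfl | rfl⟩
  · simpa using hnat m
  · have h : z ^ (-(m : ℤ)) - 1 = -(z ^ (-(m : ℤ)) * (z ^ m - 1)) := by
      rw [zpow_neg, zpow_natCast]
      field_simp
      ring
    rw [h, norm_neg, norm_mul, norm_zpow, hz, one_zpow, one_mul]
    simpa using hnat m

lemma tsum_one_sub_mul_quintTerm (hQ0 : Q ≠ 0) (hQ : ‖Q‖ < 1) (hz : ‖z‖ = 1) :
    ∑' k, (1 - z * (Q ^ 2) ^ k) * quintTerm Q z k =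
      ∑' k : ℤ, Q ^ (3 * k ^ 2 + k) * (z ^ (-3 * k) * (1 - z ^ (6 * k + 1))) := by
  have hz0 : z ≠ 0 := by rw [← norm_ne_zero_iff, hz]; exact one_ne_zero
  have hsum : Summable fun k : ℤ ↦ ‖Q‖ ^ k.natAbs :=
    (summable_linear_mul_pow_natAbs (norm_nonneg Q) hQ).of_nonneg_of_le (fun _ ↦ by positivity)
      fun k ↦ le_mul_of_one_le_left (by positivity) (by simp)
  have h1 : Summable fun k : ℤ ↦ z ^ (3 * k) * Q ^ (3 * k ^ 2 - k) :=
    hsum.of_norm_bounded fun k ↦ by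
      rw [norm_mul, norm_zpow, hz, one_zpow, one_mul]
      exact norm_zpow_le_pow_natAbs hQ0 hQ (abs_le_three_mul_sq_sub k)
  have h2 : Summable fun k : ℤ ↦ z ^ (3 * k + 1) * Q ^ (3 * k ^ 2 + k) :=
    hsum.of_norm_bounded fun k ↦ by
      rw [norm_mul, norm_zpow, hz, one_zpow, one_mul]
      exact norm_zpow_le_pow_natAbs hQ0 hQ (abs_le_three_mul_sq_add k)
  have h1' : Summable fun k : ℤ ↦ z ^ (3 * -k) * Q ^ (3 * (-k) ^ 2 - -k) :=
    (Equiv.neg ℤ).summable_iff.mpr h1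
  simp_rw [one_sub_mul_quintTerm hQ0 hz0]
  rw [h1.tsum_sub h2, ← (Equiv.neg ℤ).tsum_eq fun k : ℤ ↦ z ^ (3 * k) * Q ^ (3 * k ^ 2 - k)]
  simp only [Equiv.neg_apply]
  rw [← h1'.tsum_sub h2]
  refine tsum_congr fun k ↦ ?_
  rw [show 3 * k + 1 = -3 * k + (6 * k + 1) by ring, zpow_add₀ hz0,
    show 3 * (-k) ^ 2 - -k = 3 * k ^ 2 + k by ring, show 3 * -k = -3 * k by ring]
  ring

theorem tsum_linear_mul_zpow (hQ0 : Q ≠ 0) (hQ : ‖Q‖ < 1) :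
    (∑' k : ℤ, Q ^ (3 * k ^ 2 + k) * ((6 * k + 1 : ℤ) : ℂ)) * qPoch (Q ^ 2) (-Q ^ 2) ^ 2 =
      qPoch (Q ^ 2) (Q ^ 2) ^ 3 := by
  have hq : ‖Q ^ 2‖ < 1 := by rw [norm_pow]; exact pow_lt_one₀ (norm_nonneg Q) hQ two_ne_zero
  have hE := continuous_qPoch hq
  have hderiv : HasDerivAt (fun θ : ℝ ↦ exp (θ * I)) I 0 := by
    have h := ((hasDerivAt_id (0 : ℝ)).ofReal_comp.mul_const I).cexp
    simpa using h
  have hne : Tendsto (fun θ : ℝ ↦ exp (θ * I)) (𝓝[≠] 0) (𝓝[≠] 1) := by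
    simpa using hderiv.tendsto_nhdsNE I_ne_zero
  have hone : Tendsto (fun θ : ℝ ↦ exp (θ * I)) (𝓝[≠] 0) (𝓝 1) :=
    hne.mono_right nhdsWithin_le_nhds
  have hL : Tendsto (fun θ : ℝ ↦ ∑' k : ℤ, Q ^ (3 * k ^ 2 + k) *
      (exp (θ * I) ^ (-3 * k) * ((exp (θ * I) ^ (6 * k + 1) - 1) / (exp (θ * I) - 1))))
      (𝓝[≠] 0) (𝓝 (∑' k : ℤ, Q ^ (3 * k ^ 2 + k) * ((6 * k + 1 : ℤ) : ℂ))) := by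
    refine tendsto_tsum_of_dominated_convergence
      (summable_linear_mul_pow_natAbs (norm_nonneg Q) hQ) (fun k ↦ ?_) ?_
    · have h1 : Tendsto (fun w : ℂ ↦ w ^ (-3 * k)) (𝓝 1) (𝓝 1) := by
        simpa using (continuousAt_zpow₀ (1 : ℂ) (-3 * k) (.inl one_ne_zero)).tendsto
      have h2 : Tendsto (fun w : ℂ ↦ (w ^ (6 * k + 1) - 1) / (w - 1)) (𝓝[≠] 1)
          (𝓝 ((6 * k + 1 : ℤ) : ℂ)) := by
        have h := (hasDerivAt_zpow (6 * k + 1) (1 : ℂ) (.inl one_ne_zero)).tendsto_slope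
        simpa [slope_fun_def_field] using h
      simpa using ((h1.comp hone).mul (h2.comp hne)).const_mul (Q ^ (3 * k ^ 2 + k))
    · refine .of_forall fun θ k ↦ ?_
      have hz : ‖exp (θ * I)‖ = 1 := norm_exp_ofReal_mul_I θ
      rw [norm_mul, norm_mul, norm_div, norm_zpow _ (-3 * k), hz, one_zpow, one_mul, mul_comm]
      gcongr
      · refine div_le_of_le_mul₀ (norm_nonneg _) (by positivity)
          ((norm_zpow_sub_one_le hz _).trans ?_)
        gcongr
        exact_mod_cast (by lia : (6 * k + 1).natAbs ≤ 6 * k.natAbs + 1)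
      · exact norm_zpow_le_pow_natAbs hQ0 hQ (abs_le_three_mul_sq_add k)
  have hD : Tendsto (fun w : ℂ ↦ qPoch (Q ^ 2) (-(Q ^ 2 * w)) * qPoch (Q ^ 2) (-(Q ^ 2 * w⁻¹)))
      (𝓝 1) (𝓝 (qPoch (Q ^ 2) (-Q ^ 2) ^ 2)) := by
    have h : ContinuousAt (fun w : ℂ ↦
        qPoch (Q ^ 2) (-(Q ^ 2 * w)) * qPoch (Q ^ 2) (-(Q ^ 2 * w⁻¹))) 1 := by
      fun_prop (disch := simp)
    simpa [ContinuousAt, ← sq] using h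
  have hN : Tendsto (fun w : ℂ ↦ qPoch (Q ^ 2) (Q ^ 2) *
      qPoch (Q ^ 2) (w ^ 2 * Q ^ 2) * qPoch (Q ^ 2) ((w ^ 2)⁻¹ * Q ^ 2))
      (𝓝 1) (𝓝 (qPoch (Q ^ 2) (Q ^ 2) ^ 3)) := by
    have h : ContinuousAt (fun w : ℂ ↦ qPoch (Q ^ 2) (Q ^ 2) *
      qPoch (Q ^ 2) (w ^ 2 * Q ^ 2) * qPoch (Q ^ 2) ((w ^ 2)⁻¹ * Q ^ 2)) 1 := by
      fun_prop (disch := simp)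
    simpa [ContinuousAt, pow_succ] using h
  refine tendsto_nhds_unique (hL.mul (hD.comp hone)) ((hN.comp hone).congr' ?_)
  filter_upwards [hne.eventually_mem self_mem_nhdsWithin] with θ hθ
  have hz : ‖exp (θ * I)‖ = 1 := norm_exp_ofReal_mul_I θ
  have h := quintuple_product hQ0 hQ hz
  rw [tsum_one_sub_mul_quintTerm hQ0 hQ hz] at h
  simp only [Function.comp_apply]
  generalize exp (θ * I) = w at hθ h
  have hw : 1 - w ≠ 0 := sub_ne_zero.mpr (Ne.symm hθ)
  have hw' : w - 1 ≠ 0 := sub_ne_zero.mpr hθ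
  refine mul_left_cancel₀ hw ?_
  rw [← h, ← mul_assoc (1 - w), ← tsum_mul_left]
  congr 1
  refine tsum_congr fun k ↦ ?_
  field_simp
  ring

end quintuple

lemma qPoch_mul_qPoch_neg {q : ℂ} (hq : ‖q‖ < 1) :
    qPoch q q * qPoch q (-q) = ∏' n : ℕ, (1 - (q ^ 2) ^ (n + 1)) := by
  rw [qPoch, qPoch, ← (multipliable_qPoch hq q).tprod_mul (multipliable_qPoch hq (-q))]
  exact tprod_congr fun n ↦ by ring

lemma tprod_one_sub_pow_succ (q : ℂ) : ∏' n : ℕ, (1 - q ^ (n + 1)) = qPoch q q := by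
  simp [qPoch, pow_succ']

/-- For every `τ` in the upper half-plane, `S_{3,1}(τ) = η(2τ)⁵/η(4τ)²`, i.e.
`∑_{k∈ℤ} (6k+1) q^{(6k+1)²/12} = q^{1/12} ∏_{n≥1} (1 − q^{2n})⁵ (1 − q^{4n})⁻²`. -/
theorem stmt_6 (τ : ℂ) (hτ : 0 < τ.im) :
    Sth 3 1 τ = dedekindEta (2 * τ) ^ 5 / dedekindEta (4 * τ) ^ 2 := by
  have hQ0 : qq τ ≠ 0 := exp_ne_zero _
  have hQ : ‖qq τ‖ < 1 := UpperHalfPlane.norm_exp_two_pi_I_lt_one ⟨τ, hτ⟩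
  have hq : ‖qq τ ^ 2‖ < 1 := by
    rw [norm_pow]
    exact pow_lt_one₀ (norm_nonneg _) hQ two_ne_zero
  have h2 : qq (2 * τ) = qq τ ^ 2 := by
    rw [qq, qq, ← exp_nat_mul]; congr 1; push_cast; ring
  have h4 : qq (4 * τ) = (qq τ ^ 2) ^ 2 := by
    rw [qq, qq, ← pow_mul, ← exp_nat_mul]; congr 1; push_cast; ring
  have hS : Sth 3 1 τ = exp (2 * ↑Real.pi * I * τ / 12) *
      ∑' k : ℤ, qq τ ^ (3 * k ^ 2 + k) * ((6 * k + 1 : ℤ) : ℂ) := by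
    rw [Sth, ← tsum_mul_left]
    refine tsum_congr fun k ↦ ?_
    have he : exp (2 * ↑Real.pi * I * τ * (((2 * ((3 : ℕ) : ℤ) * k + 1 : ℤ) : ℂ) ^ 2 /
        (4 * ((3 : ℕ) : ℂ)))) =
          exp (2 * ↑Real.pi * I * τ / 12) * qq τ ^ (3 * k ^ 2 + k) := by
      rw [qq, ← exp_int_mul, ← exp_add]; congr 1; push_cast; ring
    rw [he]
    push_cast
    ring
  have hE := tsum_linear_mul_zpow hQ0 hQ
  have hE1 : qPoch (qq τ ^ 2) (qq τ ^ 2) ≠ 0 := qPoch_ne_zero hq hq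
  have hE2 : qPoch (qq τ ^ 2) (-qq τ ^ 2) ≠ 0 := qPoch_ne_zero hq (by rwa [norm_neg])
  have hexp : exp (2 * ↑Real.pi * I * τ / 12) * exp (2 * ↑Real.pi * I * (4 * τ) / 24) ^ 2 =
      exp (2 * ↑Real.pi * I * (2 * τ) / 24) ^ 5 := by
    rw [← exp_nat_mul, ← exp_nat_mul, ← exp_add]; congr 1; push_cast; ring
  rw [hS, dedekindEta, dedekindEta, h2, h4, ← qPoch_mul_qPoch_neg hq, tprod_one_sub_pow_succ,
    eq_div_iff (pow_ne_zero 2 (mul_ne_zero (exp_ne_zero _) (mul_ne_zero hE1 hE2)))]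
  linear_combination (qPoch (qq τ ^ 2) (qq τ ^ 2) ^ 2 *
    exp (2 * ↑Real.pi * I * (2 * τ) / 24) ^ 5) * hE +
    (∑' k : ℤ, qq τ ^ (3 * k ^ 2 + k) * ((6 * k + 1 : ℤ) : ℂ)) *
      (qPoch (qq τ ^ 2) (qq τ ^ 2) * qPoch (qq τ ^ 2) (-qq τ ^ 2)) ^ 2 * hexp
end
end
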